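/- For every n ≥ 2, 0 ≤ k ≤ n and 1 ≤ i ≤ n−1, the operator P_k := (1/[n choose k])·E^{(k)}∘F^{(k)} restricted to the weight space W_k is annihilated by the Temperley-Lieb operators on both sides: U_i∘P_k = 0 and P_k∘U_i = 0 as operators on W_k. -/

import Mathlib

set_option maxHeartbeats 1000000
set_option synthInstance.maxHeartbeats 400000

/-! Common setup: `Fq = ℚ(q)`, the tensor power `V^{⊗n}` of `V = Fq²` realized as
functions on the set of `{0,1}`-sequences (its standard basis), the Temperley-Lieb
and braid operators `U_i, t_i, t_i'`, the quantum `sl₂` operators `E, F, K^{⊗n}`,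
weight spaces, quantum integers and the Jones-Wenzl operators. -/

noncomputable section

/-- The field `ℚ(q)` of rational functions. -/
abbrev Fq := RatFunc ℚ

/-- The variable `q`. -/
def q : Fq := RatFunc.X

/-- `V^{⊗n}` for `V = Fq²`: functions on the index set of the standard basis
`v_{i₁} ⊗ ⋯ ⊗ v_{iₙ}`, `i_r ∈ {0,1}` (here `false ↔ v₀`, `true ↔ v₁`). -/
abbrev Tens (n : ℕ) := (Fin n → Bool) → Fq

/-- Coefficients of `Ũ` on `V ⊗ V`: `uCoef a b c d` is the coefficient of
`v_c ⊗ v_d` in `Ũ(v_a ⊗ v_b)`. -/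
def uCoef : Bool → Bool → Bool → Bool → Fq
  | false, true, true, false => 1
  | false, true, false, true => -q
  | true, false, true, false => -q⁻¹
  | true, false, false, true => 1
  | _, _, _, _ => 0

/-- Coefficients of `t̃` on `V ⊗ V`. -/
def tCoef : Bool → Bool → Bool → Bool → Fq
  | false, false, false, false => 1
  | true, true, true, true => 1
  | false, true, true, false => q
  | false, true, false, true => 1 - q ^ 2
  | true, false, false, true => q
  | _, _, _, _ => 0

/-- Coefficients of `t̃′` on `V ⊗ V`. -/
def tpCoef : Bool → Bool → Bool → Bool → Fq
  | false, false, false, false => 1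
  | true, true, true, true => 1
  | false, true, true, false => q⁻¹
  | true, false, true, false => 1 - (q ^ 2)⁻¹
  | true, false, false, true => q⁻¹
  | _, _, _, _ => 0

/-- Matrix of the operator `id^{⊗(i-1)} ⊗ T ⊗ id^{⊗(n-i-1)}` acting on the
(1-based) tensor factors `i, i+1` of `V^{⊗n}`, where `T` has coefficient matrix `m`:
the `(t, s)` entry is the coefficient of the basis vector indexed by `t` in the image
of the basis vector indexed by `s`. -/
def locMat (n : ℕ) (m : Bool → Bool → Bool → Bool → Fq) (i : ℕ) :
    Matrix (Fin n → Bool) (Fin n → Bool) Fq := fun t s =>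
  if h : 1 ≤ i ∧ i < n then
    let i0 : Fin n := ⟨i - 1, by omega⟩
    let i1 : Fin n := ⟨i, by omega⟩
    if s = Function.update (Function.update t i0 (s i0)) i1 (s i1) then
      m (s i0) (s i1) (t i0) (t i1)
    else 0
  else 0

/-- The Temperley-Lieb operator `U_i = id^{⊗(i-1)} ⊗ Ũ ⊗ id^{⊗(n-i-1)}` (1-based `i`). -/
def Uop (n i : ℕ) : Module.End Fq (Tens n) := (locMat n uCoef i).mulVecLin

/-- The braid operator `t_i = id^{⊗(i-1)} ⊗ t̃ ⊗ id^{⊗(n-i-1)}` (1-based `i`). -/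
def tOp (n i : ℕ) : Module.End Fq (Tens n) := (locMat n tCoef i).mulVecLin

/-- The inverse braid operator `t_i′ = id^{⊗(i-1)} ⊗ t̃′ ⊗ id^{⊗(n-i-1)}` (1-based `i`). -/
def tpOp (n i : ℕ) : Module.End Fq (Tens n) := (locMat n tpCoef i).mulVecLin

/-- Number of indices `r` with `i_r = 1` in the basis index `s`. -/
def countOnes {n : ℕ} (s : Fin n → Bool) : ℕ := (Finset.univ.filter fun r => s r = true).card

/-- The weight space `W_k = V₁^{⊗n}[-n+2k]`: the span of the standard basis vectors
with exactly `k` of the `i_r` equal to `1`. -/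
def weightSpace (n k : ℕ) : Submodule Fq (Tens n) :=
  Submodule.span Fq {ψ : Tens n | ∃ s : Fin n → Bool, countOnes s = k ∧ ψ = Pi.single s 1}

/-- Eigenvalue of `K` on `v_b`. -/
def kval (b : Bool) : Fq := if b then q else q⁻¹

/-- Matrix of `E = Σ_j K^{⊗(j-1)} ⊗ e ⊗ id^{⊗(n-j)}` on `V^{⊗n}`. -/
def Emat (n : ℕ) : Matrix (Fin n → Bool) (Fin n → Bool) Fq := fun t s =>
  ∑ j : Fin n,
    if s j = false ∧ t = Function.update s j true then
      ∏ r ∈ Finset.univ.filter fun r => r < j, kval (s r)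
    else 0

/-- Matrix of `F = Σ_j id^{⊗(j-1)} ⊗ f ⊗ (K⁻¹)^{⊗(n-j)}` on `V^{⊗n}`. -/
def Fmat (n : ℕ) : Matrix (Fin n → Bool) (Fin n → Bool) Fq := fun t s =>
  ∑ j : Fin n,
    if s j = true ∧ t = Function.update s j false then
      ∏ r ∈ Finset.univ.filter fun r => j < r, (kval (s r))⁻¹
    else 0

/-- The operator `E` on `V^{⊗n}`. -/
def Eop (n : ℕ) : Module.End Fq (Tens n) := (Emat n).mulVecLin

/-- The operator `F` on `V^{⊗n}`. -/
def Fop (n : ℕ) : Module.End Fq (Tens n) := (Fmat n).mulVecLin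

/-- The operator `𝐊 = K^{⊗n}` on `V^{⊗n}`. -/
def Kop (n : ℕ) : Module.End Fq (Tens n) :=
  (Matrix.diagonal fun s : Fin n → Bool => ∏ r, kval (s r)).mulVecLin

/-- The operator `𝐊⁻¹ = (K⁻¹)^{⊗n}` on `V^{⊗n}`. -/
def Kinvop (n : ℕ) : Module.End Fq (Tens n) :=
  (Matrix.diagonal fun s : Fin n → Bool => (∏ r, kval (s r))⁻¹).mulVecLin

/-- The quantum integer `[m] = (q^m - q^{-m})/(q - q⁻¹)`. -/
def qint (m : ℕ) : Fq := (q ^ m - q⁻¹ ^ m) / (q - q⁻¹)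

/-- The quantum factorial `[m]! = [1][2]⋯[m]`. -/
def qfact (m : ℕ) : Fq := ∏ i ∈ Finset.range m, qint (i + 1)

/-- The quantum binomial coefficient `[n choose k] = [n]!/([k]!·[n-k]!)`. -/
def qbinom (n k : ℕ) : Fq := qfact n / (qfact k * qfact (n - k))

/-- The divided power `E^{(k)} = E^k/[k]!`. -/
def Ediv (n k : ℕ) : Module.End Fq (Tens n) := (qfact k)⁻¹ • (Eop n) ^ k

/-- The divided power `F^{(k)} = F^k/[k]!`. -/
def Fdiv (n k : ℕ) : Module.End Fq (Tens n) := (qfact k)⁻¹ • (Fop n) ^ k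

/-- The operator `P_k = (1/[n choose k])·E^{(k)} ∘ F^{(k)}` (the Jones-Wenzl projector
on the weight space `W_k`). -/
def JW (n k : ℕ) : Module.End Fq (Tens n) := (qbinom n k)⁻¹ • (Ediv n k ∘ₗ Fdiv n k)

/-- The vectors `l_r` (1-based): `l_r = v₀^{⊗(r-1)} ⊗ (v₁⊗v₀ - q·v₀⊗v₁) ⊗ v₀^{⊗(n-r-1)}`
for `r ≠ n`, and `l_n = v₀^{⊗(n-1)} ⊗ v₁`. -/
def ell (n j : ℕ) : Tens n :=
  if j = n then Pi.single (fun r => decide (r.val = n - 1)) 1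
  else (Pi.single (fun r => decide (r.val = j - 1)) 1 : Tens n)
      - q • (Pi.single (fun r => decide (r.val = j)) 1 : Tens n)

/-- The span of `l_1, …, l_n`. -/
def ellSpan (n : ℕ) : Submodule Fq (Tens n) :=
  Submodule.span Fq {v : Tens n | ∃ j, 1 ≤ j ∧ j ≤ n ∧ v = ell n j}

open Matrix

/-- The relation `φ(…01…) = q⁻¹ φ(…10…)` at the positions `a, b`; for adjacent positions it
describes the kernel of the corresponding Temperley-Lieb operator. -/
def SwapRel {n : ℕ} (a b : Fin n) (φ : Tens n) : Prop :=
  ∀ s : Fin n → Bool, s a = false → s b = true → φ s = q⁻¹ * φ (s ∘ Equiv.swap a b)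

/-- `ψ` vanishes on the basis indices with a number of ones other than `k`. -/
def SupportedOn {n : ℕ} (k : ℕ) (ψ : Tens n) : Prop :=
  ∀ s, countOnes s ≠ k → ψ s = 0

/-- The operator changing one entry `0` into `1` at a time, with weights depending on the
position and on the resulting sequence. -/
def raise {n : ℕ} (w : Fin n → (Fin n → Bool) → Fq) (φ : Tens n) : Tens n := fun t =>
  ∑ j : Fin n, if t j = true then w j t * φ (Function.update t j false) else 0

lemma q_ne_zero : q ≠ 0 := RatFunc.X_ne_zero

lemma SwapRel.raise {n : ℕ} {a b : Fin n} {w : Fin n → (Fin n → Bool) → Fq}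
    (hab : a ≠ b)
    (hw : ∀ j s, j ≠ a → j ≠ b → w j (s ∘ Equiv.swap a b) = w j s)
    (hw' : ∀ s, s a = false → s b = true → w b s = q⁻¹ * w a (s ∘ Equiv.swap a b))
    {φ : Tens n} (hφ : SwapRel a b φ) : SwapRel a b (raise w φ) := by
  intro s ha hb
  unfold _root_.raise
  rw [Finset.mul_sum]
  refine Fintype.sum_equiv (Equiv.swap a b) _ _ fun j => ?_
  simp only [Equiv.swap_apply_self, Function.comp_apply]
  by_cases hj : s j = true
  swap
  · simp [hj]
  have hja : j ≠ a := by rintro rfl; simp [ha] at hj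
  have hupd : Function.update (s ∘ Equiv.swap a b) (Equiv.swap a b j) false
      = Function.update s j false ∘ Equiv.swap a b := by
    ext r
    simp only [Function.update_apply, Function.comp_apply, Equiv.swap_apply_eq_iff]
  simp only [hj, if_true]
  rw [hupd]
  by_cases hjb : j = b
  · subst hjb
    have : Function.update s j false ∘ Equiv.swap a j = Function.update s j false := by
      ext r
      simp only [Function.comp_apply, Equiv.swap_apply_def, Function.update_apply]
      split_ifs <;> simp_all
    rw [this, Equiv.swap_apply_right, hw' s ha hb, mul_assoc]
  · rw [Equiv.swap_apply_of_ne_of_ne hja hjb, hw j s hja hjb,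
      hφ (Function.update s j false) (by simp [Function.update_apply, ha])
        (by rw [Function.update_of_ne (Ne.symm hjb), hb])]
    ring

lemma Emat_mulVec {n : ℕ} (φ : Tens n) :
    Emat n *ᵥ φ = raise (fun j t => ∏ r ∈ Finset.univ.filter fun r => r < j, kval (t r)) φ := by
  ext t
  simp only [Matrix.mulVec, dotProduct, Emat, raise, Finset.sum_mul]
  rw [Finset.sum_comm]
  refine Finset.sum_congr rfl fun j _ => ?_
  rw [Finset.sum_eq_single (Function.update t j false)]
  · have : (t = Function.update t j true) ↔ t j = true := by
      rw [eq_comm, Function.update_eq_self_iff, eq_comm]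
    simp only [Function.update_self, Function.update_idem, true_and, this, ite_mul, zero_mul]
    split_ifs
    · congr 1
      refine Finset.prod_congr rfl fun r hr => ?_
      rw [Function.update_of_ne (Finset.mem_filter.1 hr).2.ne]
    · rfl
  · intro s _ hs
    rw [if_neg, zero_mul]
    rintro ⟨h, rfl⟩
    apply hs
    rw [Function.update_idem, ← h, Function.update_eq_self]
  · simp

lemma Fmat_transpose_mulVec {n : ℕ} (φ : Tens n) :
    (Fmat n)ᵀ *ᵥ φ =
      raise (fun j t => ∏ r ∈ Finset.univ.filter fun r => j < r, (kval (t r))⁻¹) φ := by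
  ext t
  simp only [Matrix.mulVec, dotProduct, Matrix.transpose_apply, Fmat, raise, Finset.sum_mul]
  rw [Finset.sum_comm]
  refine Finset.sum_congr rfl fun j _ => ?_
  rw [Finset.sum_eq_single (Function.update t j false)]
  · simp
  · intro s _ hs
    rw [if_neg, zero_mul]
    exact fun h => hs h.2
  · simp

lemma swap_prod_filter {n : ℕ} {a b : Fin n} (p : Fin n → Prop) [DecidablePred p]
    (hp : p a ↔ p b) (s : Fin n → Bool) (f : Bool → Fq) :
    ∏ r ∈ Finset.univ.filter p, f ((s ∘ Equiv.swap a b) r)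
      = ∏ r ∈ Finset.univ.filter p, f (s r) := by
  refine Finset.prod_equiv (Equiv.swap a b) (fun r => ?_) (fun r _ => rfl)
  simp only [Finset.mem_filter, Finset.mem_univ, true_and, Equiv.swap_apply_def]
  split_ifs <;> simp_all

lemma SwapRel.Emat_mulVec {n : ℕ} {a b : Fin n} (hab : b.val = a.val + 1) {φ : Tens n}
    (hφ : SwapRel a b φ) : SwapRel a b (Emat n *ᵥ φ) := by
  rw [_root_.Emat_mulVec]
  refine hφ.raise (Fin.ne_of_val_ne (by omega)) (fun j s hja hjb => ?_) (fun s ha hb => ?_)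
  · refine swap_prod_filter _ ?_ s kval
    rw [Fin.lt_def, Fin.lt_def]
    have := Fin.val_ne_of_ne hja
    omega
  · have hset : (Finset.univ.filter fun r => r < b)
        = insert a (Finset.univ.filter fun r => r < a) := by
      ext r
      simp only [Finset.mem_filter, Finset.mem_univ, true_and, Finset.mem_insert, Fin.lt_def,
        Fin.ext_iff]
      omega
    rw [hset, Finset.prod_insert (by simp), ha,
      swap_prod_filter (fun r => r < a) (by rw [Fin.lt_def, Fin.lt_def]; omega) s kval]
    simp [kval]

lemma SwapRel.Fmat_transpose_mulVec {n : ℕ} {a b : Fin n} (hab : b.val = a.val + 1) {φ : Tens n}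
    (hφ : SwapRel a b φ) : SwapRel a b ((Fmat n)ᵀ *ᵥ φ) := by
  rw [_root_.Fmat_transpose_mulVec]
  refine hφ.raise (Fin.ne_of_val_ne (by omega)) (fun j s hja hjb => ?_) (fun s ha hb => ?_)
  · refine swap_prod_filter _ ?_ s fun c => (kval c)⁻¹
    rw [Fin.lt_def, Fin.lt_def]
    have := Fin.val_ne_of_ne hjb
    omega
  · have hset : (Finset.univ.filter fun r => a < r)
        = insert b (Finset.univ.filter fun r => b < r) := by
      ext r
      simp only [Finset.mem_filter, Finset.mem_univ, true_and, Finset.mem_insert, Fin.lt_def,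
        Fin.ext_iff]
      omega
    rw [hset, Finset.prod_insert (by simp),
      swap_prod_filter (fun r => b < r) (by rw [Fin.lt_def, Fin.lt_def]; omega) s fun c => (kval c)⁻¹]
    simp [kval, ha, q_ne_zero]

lemma SwapRel.single_zero {n : ℕ} (a b : Fin n) :
    SwapRel a b (Pi.single (fun _ => false) 1 : Tens n) := by
  intro s ha hb
  rw [Pi.single_eq_of_ne, Pi.single_eq_of_ne, mul_zero]
  · intro h
    have := congrFun h a
    simp [hb] at this
  · intro h
    have := congrFun h b
    simp [hb] at this

lemma SwapRel.pow_mulVec {n : ℕ} {a b : Fin n}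
    {M : Matrix (Fin n → Bool) (Fin n → Bool) Fq}
    (hM : ∀ φ : Tens n, SwapRel a b φ → SwapRel a b (M *ᵥ φ)) {φ : Tens n}
    (hφ : SwapRel a b φ) (k : ℕ) : SwapRel a b (M ^ k *ᵥ φ) := by
  induction k with
  | zero => simpa using hφ
  | succ k ih =>
    rw [pow_succ', ← Matrix.mulVec_mulVec]
    exact hM _ ih

lemma eq_update_update_iff {n : ℕ} {a b : Fin n} (s t : Fin n → Bool) :
    s = Function.update (Function.update t a (s a)) b (s b) ↔
      ∀ r, r ≠ a → r ≠ b → s r = t r := by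
  constructor
  · intro h r hra hrb
    rw [h, Function.update_of_ne hrb, Function.update_of_ne hra]
  · intro h
    ext r
    by_cases hrb : r = b
    · subst hrb; simp
    by_cases hra : r = a
    · subst hra; simp [hrb]
    · simp [hra, hrb, h r hra hrb]

lemma locMat_apply {n i : ℕ} (m : Bool → Bool → Bool → Bool → Fq) {a b : Fin n}
    (ha : a.val + 1 = i) (hb : b.val = i) (t s : Fin n → Bool) :
    locMat n m i t s =
      if ∀ r, r ≠ a → r ≠ b → s r = t r then m (s a) (s b) (t a) (t b) else 0 := by
  have hi : 1 ≤ i ∧ i < n := ⟨by omega, hb ▸ b.isLt⟩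
  have ha' : (⟨i - 1, by omega⟩ : Fin n) = a := Fin.ext (by simp; omega)
  have hb' : (⟨i, by omega⟩ : Fin n) = b := Fin.ext hb.symm
  simp only [locMat, hi, and_self, dif_pos, ha', hb', eq_update_update_iff]

lemma locMat_uCoef_transpose {n i : ℕ} {a b : Fin n} (ha : a.val + 1 = i) (hb : b.val = i) :
    (locMat n uCoef i)ᵀ = locMat n uCoef i := by
  ext t s
  have hsymm : ∀ c d c' d', uCoef c d c' d' = uCoef c' d' c d := by
    intro c d c' d'
    cases c <;> cases d <;> cases c' <;> cases d' <;> rfl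
  rw [Matrix.transpose_apply, locMat_apply _ ha hb, locMat_apply _ ha hb, hsymm]
  simp only [eq_comm]

lemma SwapRel.locMat_mulVec_eq_zero {n i : ℕ} {a b : Fin n} (ha : a.val + 1 = i)
    (hb : b.val = i) {φ : Tens n} (hφ : SwapRel a b φ) : locMat n uCoef i *ᵥ φ = 0 := by
  have hab : a ≠ b := Fin.ne_of_val_ne (by omega)
  ext t
  set s := Function.update (Function.update t a false) b true with hs
  have hsa : s a = false := by simp [hs, hab]
  have hsb : s b = true := by simp [hs]
  have hsr : ∀ r, r ≠ a → r ≠ b → s r = t r := fun r h h' => by simp [hs, h, h']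
  set s' := s ∘ Equiv.swap a b with hs'
  have hsa' : s' a = true := by simp [hs', hsb]
  have hsb' : s' b = false := by simp [hs', hsa]
  have hsr' : ∀ r, r ≠ a → r ≠ b → s' r = t r := fun r h h' => by
    simp [hs', Equiv.swap_apply_of_ne_of_ne h h', hsr r h h']
  have hne : s ≠ s' := fun h => by simp [← h, hsa] at hsa'
  have hext : ∀ x y : Fin n → Bool, x a = y a → x b = y b →
      (∀ r, r ≠ a → r ≠ b → x r = t r) → (∀ r, r ≠ a → r ≠ b → y r = t r) → x = y := by
    intro x y h1 h2 h3 h4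
    ext r
    by_cases hra : r = a
    · rw [hra, h1]
    by_cases hrb : r = b
    · rw [hrb, h2]
    rw [h3 r hra hrb, h4 r hra hrb]
  simp only [Matrix.mulVec, dotProduct, Pi.zero_apply]
  rw [Finset.sum_eq_add s s' hne]
  · rw [locMat_apply _ ha hb, locMat_apply _ ha hb, if_pos hsr, if_pos hsr', hsa, hsb, hsa', hsb',
      hφ s hsa hsb, ← hs']
    have := q_ne_zero
    cases t a <;> cases t b <;> simp [uCoef, this]
  · rintro x - ⟨hx, hx'⟩
    rw [locMat_apply _ ha hb]
    split_ifs with h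
    · rcases hxa : x a <;> rcases hxb : x b
      · simp [uCoef]
      · exact absurd (hext x s (by rw [hxa, hsa]) (by rw [hxb, hsb]) h hsr) hx
      · exact absurd (hext x s' (by rw [hxa, hsa']) (by rw [hxb, hsb']) h hsr') hx'
      · simp [uCoef]
    · simp
  · simp
  · simp

lemma supportedOn_of_mem_weightSpace {n k : ℕ} {ψ : Tens n} (hψ : ψ ∈ weightSpace n k) :
    SupportedOn k ψ := by
  induction hψ using Submodule.span_induction with
  | mem x h =>
    obtain ⟨s, hs, rfl⟩ := h
    intro t ht
    rw [Pi.single_eq_of_ne]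
    rintro rfl
    exact ht hs
  | zero => exact fun _ _ => rfl
  | add x y _ _ hx hy => exact fun s hs => by simp [hx s hs, hy s hs]
  | smul c x _ hx => exact fun s hs => by simp [hx s hs]

lemma SupportedOn.mulVec {n k l : ℕ} {M : Matrix (Fin n → Bool) (Fin n → Bool) Fq}
    (hM : ∀ t s, M t s ≠ 0 → countOnes s = k → countOnes t = l) {ψ : Tens n}
    (hψ : SupportedOn k ψ) : SupportedOn l (M *ᵥ ψ) := by
  intro t ht
  refine Finset.sum_eq_zero fun s _ => ?_
  change M t s * ψ s = 0
  by_cases hs : countOnes s = k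
  · rw [not_imp_comm.1 (hM t s) fun h => ht (h hs), zero_mul]
  · rw [hψ s hs, mul_zero]

lemma countOnes_comp_equiv {n : ℕ} (s : Fin n → Bool) (σ : Equiv.Perm (Fin n)) :
    countOnes (s ∘ σ) = countOnes s := by
  unfold countOnes
  exact Finset.card_equiv σ (by simp)

lemma countOnes_update_false {n : ℕ} {s : Fin n → Bool} {j : Fin n} (hj : s j = true) :
    countOnes (Function.update s j false) + 1 = countOnes s := by
  unfold countOnes
  rw [← Finset.card_erase_add_one (s := Finset.univ.filter fun r => s r = true) (a := j)
    (by simp [hj])]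
  congr 2
  ext r
  by_cases h : r = j <;> simp [h]

lemma SupportedOn.Fmat_mulVec {n k : ℕ} {ψ : Tens n} (hψ : SupportedOn (k + 1) ψ) :
    SupportedOn k (Fmat n *ᵥ ψ) := by
  refine hψ.mulVec fun t s h hs => ?_
  obtain ⟨j, -, hj⟩ := Finset.exists_ne_zero_of_sum_ne_zero h
  obtain ⟨⟨h1, rfl⟩, -⟩ := ite_ne_right_iff.1 hj
  have := countOnes_update_false h1
  omega

lemma SupportedOn.Fmat_pow_mulVec {n k : ℕ} {ψ : Tens n} (hψ : SupportedOn k ψ) :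
    SupportedOn 0 (Fmat n ^ k *ᵥ ψ) := by
  induction k generalizing ψ with
  | zero => simpa using hψ
  | succ k ih =>
    rw [pow_succ, ← Matrix.mulVec_mulVec]
    exact ih hψ.Fmat_mulVec

lemma SupportedOn.locMat_mulVec {n i k : ℕ} {a b : Fin n} (ha : a.val + 1 = i)
    (hb : b.val = i) {ψ : Tens n} (hψ : SupportedOn k ψ) :
    SupportedOn k (locMat n uCoef i *ᵥ ψ) := by
  refine hψ.mulVec fun t s h hs => ?_
  rw [locMat_apply _ ha hb] at h
  obtain ⟨hr, hu⟩ := ite_ne_right_iff.1 h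
  have key : t = s ∨ t = s ∘ Equiv.swap a b := by
    have hcoef : (t a = s a ∧ t b = s b) ∨ (t a = s b ∧ t b = s a) := by
      revert hu
      cases s a <;> cases s b <;> cases t a <;> cases t b <;> simp [uCoef]
    refine hcoef.imp (fun h => ?_) (fun h => ?_) <;> ext r <;>
      by_cases hra : r = a <;> by_cases hrb : r = b
    all_goals
      first
      | simp [Equiv.swap_apply_of_ne_of_ne hra hrb, hr r hra hrb]
      | simp_all
  rcases key with rfl | rfl
  · exact hs
  · rw [countOnes_comp_equiv, hs]

lemma SupportedOn.eq_smul_single {n : ℕ} {ψ : Tens n} (hψ : SupportedOn 0 ψ) :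
    ψ = ψ (fun _ => false) • (Pi.single (fun _ => false) 1 : Tens n) := by
  ext s
  by_cases hs : s = fun _ => false
  · simp [hs]
  · rw [hψ s, Pi.smul_apply, Pi.single_eq_of_ne hs, smul_zero]
    intro h
    apply hs
    ext r
    have := Finset.filter_eq_empty_iff.1 (Finset.card_eq_zero.1 h) (Finset.mem_univ r)
    simpa using this

lemma JW_apply (n k : ℕ) (ψ : Tens n) :
    ∃ c : Fq, JW n k ψ = c • (Emat n ^ k *ᵥ (Fmat n ^ k *ᵥ ψ)) := by
  have hpow : ∀ M : Matrix (Fin n → Bool) (Fin n → Bool) Fq,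
      M.mulVecLin ^ k = (M ^ k).mulVecLin := fun M => by
    induction k with
    | zero => simp [Module.End.one_eq_id]
    | succ k ih => rw [pow_succ, pow_succ, ih, Matrix.mulVecLin_mul]; rfl
  refine ⟨(qbinom n k)⁻¹ * ((qfact k)⁻¹ * (qfact k)⁻¹), ?_⟩
  simp only [JW, Ediv, Fdiv, Eop, Fop, hpow, LinearMap.smul_apply, LinearMap.comp_apply,
    map_smul, Matrix.mulVecLin_apply, smul_smul]

/-- the operator `P_k` restricted to `W_k` is annihilated by the
Temperley-Lieb operators on both sides: `U_i ∘ P_k = 0` and `P_k ∘ U_i = 0` on `W_k`. -/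
theorem jones_wenzl_annihilated_by_TL (n : ℕ) (hn : 2 ≤ n) (k : ℕ) (hk : k ≤ n)
    (i : ℕ) (hi1 : 1 ≤ i) (hi2 : i ≤ n - 1) :
    (∀ ψ ∈ weightSpace n k, Uop n i (JW n k ψ) = 0) ∧
    (∀ ψ ∈ weightSpace n k, JW n k (Uop n i ψ) = 0) := by
  let a : Fin n := ⟨i - 1, by omega⟩
  let b : Fin n := ⟨i, by omega⟩
  have ha : a.val + 1 = i := by simp only [a]; omega
  have hb : b.val = i := rfl
  have hab : b.val = a.val + 1 := by omega
  refine ⟨fun ψ hψ => ?_, fun ψ hψ => ?_⟩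
  · obtain ⟨c, hc⟩ := JW_apply n k ψ
    rw [hc, Uop, Matrix.mulVecLin_apply,
      (supportedOn_of_mem_weightSpace hψ).Fmat_pow_mulVec.eq_smul_single]
    simp only [Matrix.mulVec_smul]
    rw [((SwapRel.single_zero a b).pow_mulVec (fun _ h => h.Emat_mulVec hab) k).locMat_mulVec_eq_zero
      ha hb, smul_zero, smul_zero]
  · obtain ⟨c, hc⟩ := JW_apply n k (Uop n i ψ)
    rw [hc, Uop, Matrix.mulVecLin_apply,
      ((supportedOn_of_mem_weightSpace hψ).locMat_mulVec ha hb).Fmat_pow_mulVec.eq_smul_single]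
    have hzero := ((SwapRel.single_zero a b).pow_mulVec
      (fun _ h => h.Fmat_transpose_mulVec hab) k).locMat_mulVec_eq_zero ha hb
    rw [← locMat_uCoef_transpose ha hb, ← Matrix.transpose_pow, Matrix.mulVec_transpose,
      Matrix.mulVec_transpose] at hzero
    have hval : (Fmat n ^ k *ᵥ (locMat n uCoef i *ᵥ ψ)) (fun _ => false) = 0 := by
      rw [← single_one_dotProduct (fun _ => false) (Fmat n ^ k *ᵥ (locMat n uCoef i *ᵥ ψ)),
        Matrix.dotProduct_mulVec, Matrix.dotProduct_mulVec, hzero, zero_dotProduct]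
    rw [hval, zero_smul, Matrix.mulVec_zero, smul_zero]
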